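/- Suppose ξ_j ≤ ξ̄ < 1 for all j ∈ J, 0 < ε < 1, and ξ̄ + ε/(1 − ξ̄) < 1. Set n₀ = ⌊ log(1 + (1/ξ̄ − 1)/ε) / log(1/ξ̄) ⌋ + 1. Let T be the tent map, x_n = Tⁿ(x_0), and define the flipped noise δ_n = ε if x_n < 1/2 and δ_n = −ε if x_n ≥ 1/2. If there exists k ≥ 0 with 0 < x_k < 1/2^{n₀+1}, then for every infinite sequence of indices j : ℕ → J there exists a stage n ≥ 1 at which the generating set merges, i.e. N_n ≥ Π_n (equivalently L_n ≥ 2Π_n). -/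

import Mathlib

open Finset Real

/-- The tent map `T(x) = 2x` for `x < 1/2` and `T(x) = 2(1-x)` for `x ≥ 1/2`. -/
noncomputable def tentMap (x : ℝ) : ℝ := if x < 1 / 2 then 2 * x else 2 * (1 - x)

/-- Below the threshold `1 / 2 ^ (i + 1)`, the first `i` tent-map iterates only double. -/
lemma tentMap_iterate_of_lt {x : ℝ} (i : ℕ) (hx : x < 1 / 2 ^ (i + 1)) :
    tentMap^[i] x = 2 ^ i * x := by
  induction i with
  | zero => simp
  | succ i ih =>
    have hlt : x < 1 / 2 ^ (i + 1) :=
      hx.trans_le (one_div_le_one_div_of_le (by positivity)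
        (pow_le_pow_right₀ one_le_two (by omega)))
    have hhalf : 2 ^ i * x < 1 / 2 := by
      rw [lt_div_iff₀ (by positivity)] at hlt
      rw [pow_succ] at hlt
      linarith
    rw [Function.iterate_succ_apply', ih hlt, tentMap, if_pos hhalf]
    ring

/-- Below the threshold `1 / 2 ^ (n + 1)`, the first `n` tent-map iterates stay below `1 / 2`. -/
lemma tentMap_iterate_lt_half {x : ℝ} {i n : ℕ} (hi : i ≤ n)
    (hx : x < 1 / 2 ^ (n + 1)) : tentMap^[i] x < 1 / 2 := by
  have hlt : x < 1 / 2 ^ (i + 1) :=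
    hx.trans_le (one_div_le_one_div_of_le (by positivity)
      (pow_le_pow_right₀ one_le_two (by omega)))
  rw [tentMap_iterate_of_lt i hlt]
  rw [lt_div_iff₀ (by positivity), pow_succ] at hlt
  linarith

/-- A recursion `D (m + 1) = c m * (D m + ε)` with small ratios and `D 0 ≥ -1` dominates a
positive multiple of a geometric sum. -/
lemma exists_pos_mul_geom_sum_le {q ε : ℝ} (hq : 0 < q) (hε : 0 ≤ ε) {D c : ℕ → ℝ}
    (hD0 : -1 ≤ D 0)
    (m : ℕ) (hc : ∀ i < m, 0 < c i ∧ c i * q ≤ 1)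
    (hD : ∀ i < m, D (i + 1) = c i * (D i + ε)) :
    ∃ a, 0 < a ∧ a * q ^ m ≤ 1 ∧ a * (-1 + ε * ∑ i ∈ range m, q ^ i) ≤ D m := by
  induction m with
  | zero => exact ⟨1, by simpa using hD0⟩
  | succ m ih =>
    obtain ⟨a, ha, haq, haD⟩ := ih (fun i hi => hc i (by omega)) (fun i hi => hD i (by omega))
    obtain ⟨hc0, hcq⟩ := hc m (by omega)
    refine ⟨c m * a, by positivity, ?_, ?_⟩
    · calc c m * a * q ^ (m + 1) = (c m * q) * (a * q ^ m) := by ring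
        _ ≤ 1 := mul_le_one₀ hcq (by positivity) haq
    · rw [hD m (by omega), sum_range_succ, mul_assoc]
      refine mul_le_mul_of_nonneg_left ?_ hc0.le
      nlinarith [mul_le_mul_of_nonneg_left haq hε]

/-- The exponent `⌊log (1 + (q - 1) / ε) / log q⌋ + 1` makes the geometric sum exceed `1 / ε`. -/
lemma one_le_mul_geom_sum_of_floor_log {q ε : ℝ} (hq : 1 < q) (hε : 0 < ε) :
    1 ≤ ε * ∑ i ∈ range (⌊log (1 + (q - 1) / ε) / log q⌋₊ + 1), q ^ i := by
  have hlt := Nat.lt_floor_add_one (log (1 + (q - 1) / ε) / log q)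
  have hq1 : 0 < q - 1 := by linarith
  rw [div_lt_iff₀ (log_pos hq), ← Nat.cast_add_one, ← log_pow,
    log_lt_log_iff (by positivity) (by positivity)] at hlt
  rw [geom_sum_eq hq.ne', ← mul_div_assoc, le_div_iff₀ hq1]
  have h : (q - 1) / ε < q ^ (⌊log (1 + (q - 1) / ε) / log q⌋₊ + 1) - 1 := by linarith
  rw [div_lt_iff₀ hε] at h
  linarith

/-- with the flipped tent-map noise `δ_n = ε` if `xₙ < 1/2`,
`δ_n = -ε` otherwise, if the orbit of `x₀` enters `(0, 1/2^(n₀+1))` then some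
generating set at a finite stage merges: `N_n ≥ Π_n`, equivalently
`L_n ≥ 2Π_n`. -/
theorem stmt_15 {J : Type*} [Fintype J] [Nonempty J]
    (ξ : J → ℝ) (hξ : ∀ a, 0 < ξ a ∧ ξ a < 1)
    (j : ℕ → J) (δ : ℕ → ℝ) (L N P : ℕ → ℝ)
    (hL0 : L 0 = 1) (hL : ∀ n, L (n + 1) = ξ (j (n + 1)) * (L n + δ (n + 1)))
    (hN0 : N 0 = 0) (hN : ∀ n, N (n + 1) = ξ (j (n + 1)) * (N n + δ (n + 1)))
    (hP : ∀ n, P n = ∏ i ∈ Finset.Icc 1 n, ξ (j i))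
    (ξbar ε : ℝ) (hξbar : ∀ a, ξ a ≤ ξbar) (hξbar1 : ξbar < 1)
    (hε0 : 0 < ε) (hε1 : ε < 1) (hcond : ξbar + ε / (1 - ξbar) < 1)
    (n₀ : ℕ)
    (hn₀ : n₀ = ⌊Real.log (1 + (1 / ξbar - 1) / ε) / Real.log (1 / ξbar)⌋₊ + 1)
    (x₀ : ℝ)
    (hδ : ∀ n, 1 ≤ n → δ n = if tentMap^[n] x₀ < 1 / 2 then ε else -ε)
    (hk : ∃ k : ℕ, 0 < tentMap^[k] x₀ ∧ tentMap^[k] x₀ < 1 / 2 ^ (n₀ + 1)) :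
    ∃ n, 1 ≤ n ∧ N n ≥ P n ∧ L n ≥ 2 * P n := by
  have hξbar0 : 0 < ξbar := (hξ (j 0)).1.trans_le (hξbar _)
  have hgap : 0 < 1 - ξbar := by linarith
  have hP0 : P 0 = 1 := by simp [hP]
  have hPsucc : ∀ n, P (n + 1) = ξ (j (n + 1)) * P n := fun n => by
    rw [hP, hP, prod_Icc_succ_top (by omega), mul_comm]
  have hLNP : ∀ n, L n = N n + P n := fun n => by
    induction n with
    | zero => rw [hL0, hN0, hP0, zero_add]
    | succ n ih => rw [hL, hN, hPsucc, ih]; ring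
  have hδ_lower : ∀ n, -ε ≤ δ (n + 1) := fun n => by
    rw [hδ _ (by omega)]
    split_ifs <;> linarith
  have hN_lower : ∀ n, -(ε / (1 - ξbar)) ≤ N n := fun n => by
    induction n with
    | zero => rw [hN0]; have := div_pos hε0 hgap; linarith
    | succ n ih =>
      obtain ⟨h0, -⟩ := hξ (j (n + 1))
      set B := ε / (1 - ξbar)
      have hB : 0 < B := div_pos hε0 hgap
      have hBε : B * (1 - ξbar) = ε := div_mul_cancel₀ _ hgap.ne'
      have hsum : -(B + ε) ≤ N n + δ (n + 1) := by linarith [hδ_lower n]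
      rw [hN]
      calc -B ≤ -(ξbar * (B + ε)) := by nlinarith
        _ ≤ -(ξ (j (n + 1)) * (B + ε)) :=
          neg_le_neg (mul_le_mul_of_nonneg_right (hξbar _) (by positivity))
        _ ≤ ξ (j (n + 1)) * (N n + δ (n + 1)) := by nlinarith
  have hP_upper : ∀ n, 0 ≤ P n ∧ P n ≤ 1 := fun n => by
    rw [hP]
    exact ⟨prod_nonneg fun i _ => (hξ _).1.le,
      prod_le_one (fun i _ => (hξ _).1.le) fun i _ => (hξ _).2.le⟩
  have hstart : ∀ n, -1 ≤ N n - P n := fun n => by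
    cases n with
    | zero => rw [hN0, hP0]; norm_num
    | succ n =>
      have : P (n + 1) ≤ ξbar := by
        rw [hPsucc]
        exact (mul_le_of_le_one_right (hξ _).1.le (hP_upper n).2).trans (hξbar _)
      linarith [hN_lower (n + 1)]
  obtain ⟨k, -, hk1⟩ := hk
  have hδ_run : ∀ i < n₀, δ (k + i + 1) = ε := fun i hi => by
    rw [hδ _ (by omega), if_pos]
    rw [show k + i + 1 = (i + 1) + k by omega, Function.iterate_add_apply]
    exact tentMap_iterate_lt_half (by omega) hk1
  have hq : 1 < 1 / ξbar := (one_lt_div hξbar0).2 hξbar1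
  obtain ⟨a, ha, -, haD⟩ := exists_pos_mul_geom_sum_le (q := 1 / ξbar) (ε := ε)
    (D := fun i => N (k + i) - P (k + i)) (c := fun i => ξ (j (k + i + 1)))
    (by positivity) hε0.le (hstart k) n₀
    (fun i _ => ⟨(hξ _).1, by
      rw [mul_one_div]
      exact (div_le_one hξbar0).2 (hξbar _)⟩)
    (fun i hi => by
      simp only [← add_assoc]
      rw [hN, hPsucc, hδ_run i hi]
      ring)
  have hsum : 1 ≤ ε * ∑ i ∈ range n₀, (1 / ξbar) ^ i := by
    rw [hn₀]
    exact one_le_mul_geom_sum_of_floor_log hq hε0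
  have hmerge : P (k + n₀) ≤ N (k + n₀) :=
    sub_nonneg.1 ((mul_nonneg ha.le (by linarith)).trans haD)
  exact ⟨k + n₀, by omega, hmerge, by linarith [hLNP (k + n₀)]⟩
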